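/- Let μ be a Borel probability measure on ℝ with mean 0 and finite variance σ² = ∫ x² dμ(x). Then the F-transform F_μ(z) = 1/∫(1/(z−x)) dμ(x) is injective on the half-plane {z ∈ ℂ : Im z > σ}. -/

import Mathlib

open MeasureTheory Complex Set

theorem sub_ofReal_ne_zero {z : ℂ} (hz : 0 < z.im) (x : ℝ) : z - (x : ℂ) ≠ 0 := fun h => by
  have := congrArg Complex.im h
  simp at this
  exact hz.ne' this

theorem continuous_inv_sub_ofReal {z : ℂ} (hz : 0 < z.im) :
    Continuous fun x : ℝ => (z - (x : ℂ))⁻¹ :=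
  (continuous_const.sub continuous_ofReal).inv₀ (sub_ofReal_ne_zero hz)

theorem norm_inv_sub_ofReal_le {z : ℂ} (hz : 0 < z.im) (x : ℝ) :
    ‖(z - (x : ℂ))⁻¹‖ ≤ z.im⁻¹ := by
  rw [norm_inv]
  refine inv_anti₀ hz ?_
  simpa [abs_of_pos hz] using Complex.abs_im_le_norm (z - (x : ℂ))

theorem integrable_inv_sub_ofReal (μ : Measure ℝ) [IsFiniteMeasure μ] {z : ℂ} (hz : 0 < z.im) :
    Integrable (fun x : ℝ => (z - (x : ℂ))⁻¹) μ :=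
  .of_bound (continuous_inv_sub_ofReal hz).aestronglyMeasurable z.im⁻¹
    (.of_forall (norm_inv_sub_ofReal_le hz))

theorem integral_inv_sub_ofReal_ne_zero (μ : Measure ℝ) [IsProbabilityMeasure μ] {z : ℂ}
    (hz : 0 < z.im) : ∫ x : ℝ, (z - (x : ℂ))⁻¹ ∂μ ≠ 0 := by
  intro h
  have hint := integrable_inv_sub_ofReal μ hz
  have hpos (x : ℝ) : 0 < -((z - (x : ℂ))⁻¹).im := by
    have := normSq_pos.2 (sub_ofReal_ne_zero hz x)
    simp only [inv_im, sub_im, ofReal_im, sub_zero, neg_div, neg_neg]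
    positivity
  have him : ∫ x : ℝ, -((z - (x : ℂ))⁻¹).im ∂μ = 0 := by
    rw [integral_neg, neg_eq_zero]
    simpa [h] using integral_im (𝕜 := ℂ) hint
  refine (ne_of_gt ?_) him
  rw [integral_pos_iff_support_of_nonneg (fun x => (hpos x).le) hint.im.neg,
    Function.support_eq_univ fun x => (hpos x).ne']
  simp

/-- The resolvent, applied to the identity function, of multiplication by `x` compressed to the
orthogonal complement of the constants in `L²(μ)`. -/
noncomputable def compressedResolvent (μ : Measure ℝ) (z : ℂ) (x : ℝ) : ℂ :=
  (∫ t : ℝ, (z - (t : ℂ))⁻¹ ∂μ)⁻¹ * (z - (x : ℂ))⁻¹ - 1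

theorem sq_im_mul_normSq_compressedResolvent_le (μ : Measure ℝ) {z : ℂ} (hz : 0 < z.im)
    (x : ℝ) :
    z.im ^ 2 * normSq (compressedResolvent μ z x) ≤ x ^ 2 + 2 * z.im *
      (((∫ t : ℝ, (z - (t : ℂ))⁻¹ ∂μ)⁻¹ - z) * starRingEnd ℂ (compressedResolvent μ z x)).im := by
  set c := (∫ t : ℝ, (z - (t : ℂ))⁻¹ ∂μ)⁻¹ - z with hc
  set h := compressedResolvent μ z x with hh
  have key : (z - x) * h = x + c := by
    have := sub_ofReal_ne_zero hz x
    rw [hh, compressedResolvent, hc, mul_sub, mul_left_comm, mul_inv_cancel₀ this]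
    ring
  have him : z.im * normSq h = -(x * h.im) + (c * starRingEnd ℂ h).im := by
    have := congrArg (fun w : ℂ => (w * starRingEnd ℂ h).im) key
    simp only [mul_assoc, mul_conj, add_mul, add_im, im_mul_ofReal, sub_im, ofReal_im,
      im_ofReal_mul, conj_im] at this
    linarith
  have hle : h.im ^ 2 ≤ normSq h := by
    rw [normSq_apply]
    nlinarith [sq_nonneg h.re]
  nlinarith [sq_nonneg (x + z.im * h.im), mul_le_mul_of_nonneg_left hle (sq_nonneg z.im)]

section compressedResolvent

variable (μ : Measure ℝ) [IsProbabilityMeasure μ] {z : ℂ}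

theorem integrable_compressedResolvent (hz : 0 < z.im) :
    Integrable (compressedResolvent μ z) μ :=
  ((integrable_inv_sub_ofReal μ hz).const_mul _).sub (integrable_const 1)

theorem integral_compressedResolvent (hz : 0 < z.im) :
    ∫ x, compressedResolvent μ z x ∂μ = 0 := by
  unfold compressedResolvent
  rw [integral_sub ((integrable_inv_sub_ofReal μ hz).const_mul _) (integrable_const 1),
    integral_const_mul, inv_mul_cancel₀ (integral_inv_sub_ofReal_ne_zero μ hz)]
  simp

theorem integrable_normSq_compressedResolvent (hz : 0 < z.im) :
    Integrable (fun x => normSq (compressedResolvent μ z x)) μ := by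
  refine .of_bound (C := (‖(∫ t : ℝ, (z - (t : ℂ))⁻¹ ∂μ)⁻¹‖ * z.im⁻¹ + 1) ^ 2)
    (continuous_normSq.comp_aestronglyMeasurable
      (integrable_compressedResolvent μ hz).aestronglyMeasurable) (.of_forall fun x => ?_)
  rw [Real.norm_of_nonneg (normSq_nonneg _), normSq_eq_norm_sq]
  gcongr
  refine (norm_sub_le _ _).trans ?_
  rw [norm_mul, norm_one]
  gcongr
  exact norm_inv_sub_ofReal_le hz x

theorem integral_normSq_compressedResolvent_le (hz : 0 < z.im)
    (h2 : Integrable (fun x : ℝ => x ^ 2) μ) :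
    z.im ^ 2 * ∫ x, normSq (compressedResolvent μ z x) ∂μ ≤ ∫ x, x ^ 2 ∂μ := by
  set c := (∫ t : ℝ, (z - (t : ℂ))⁻¹ ∂μ)⁻¹ - z with hc
  have hint := integrable_compressedResolvent μ hz
  have hci : Integrable (fun x => c * starRingEnd ℂ (compressedResolvent μ z x)) μ :=
    ((conjCLE : ℂ →L[ℝ] ℂ).integrable_comp hint).const_mul c
  have hzero : ∫ x, (c * starRingEnd ℂ (compressedResolvent μ z x)).im ∂μ = 0 := by
    have := integral_im (𝕜 := ℂ) hci
    rw [integral_const_mul, integral_conj, integral_compressedResolvent μ hz] at this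
    simpa using this
  have himi : Integrable (fun x => (c * starRingEnd ℂ (compressedResolvent μ z x)).im) μ := hci.im
  calc z.im ^ 2 * ∫ x, normSq (compressedResolvent μ z x) ∂μ
      = ∫ x, z.im ^ 2 * normSq (compressedResolvent μ z x) ∂μ := (integral_const_mul _ _).symm
    _ ≤ ∫ x, x ^ 2 + 2 * z.im * (c * starRingEnd ℂ (compressedResolvent μ z x)).im ∂μ :=
        integral_mono ((integrable_normSq_compressedResolvent μ hz).const_mul _)
          (h2.add (himi.const_mul _)) (sq_im_mul_normSq_compressedResolvent_le μ hz)
    _ = ∫ x, x ^ 2 ∂μ := by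
        rw [integral_add h2 (himi.const_mul _), integral_const_mul, hzero, mul_zero, add_zero]

theorem integral_normSq_compressedResolvent_lt_one (h2 : Integrable (fun x : ℝ => x ^ 2) μ)
    (hz : Real.sqrt (∫ x : ℝ, x ^ 2 ∂μ) < z.im) :
    ∫ x, normSq (compressedResolvent μ z x) ∂μ < 1 := by
  have hpos : 0 < z.im := (Real.sqrt_nonneg _).trans_lt hz
  have := integral_normSq_compressedResolvent_le μ hpos h2
  have := (Real.sqrt_lt' hpos).1 hz
  by_contra! hge
  nlinarith [mul_le_mul_of_nonneg_left hge (sq_nonneg z.im)]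

theorem integral_compressedResolvent_mul {w : ℂ} (hz : 0 < z.im) (hw : 0 < w.im) (hne : z ≠ w) :
    ∫ x, compressedResolvent μ z x * compressedResolvent μ w x ∂μ =
      ((∫ x : ℝ, (z - (x : ℂ))⁻¹ ∂μ)⁻¹ - (∫ x : ℝ, (w - (x : ℂ))⁻¹ ∂μ)⁻¹) / (z - w) - 1 := by
  have hGz := integral_inv_sub_ofReal_ne_zero μ hz
  have hGw := integral_inv_sub_ofReal_ne_zero μ hw
  have hiz := integrable_inv_sub_ofReal μ hz
  have hiw := integrable_inv_sub_ofReal μ hw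
  have hsub := sub_ne_zero.2 hne
  unfold compressedResolvent
  set A := ∫ x : ℝ, (z - (x : ℂ))⁻¹ ∂μ with hA
  set B := ∫ x : ℝ, (w - (x : ℂ))⁻¹ ∂μ with hB
  have hexp (x : ℝ) : (A⁻¹ * (z - (x : ℂ))⁻¹ - 1) * (B⁻¹ * (w - (x : ℂ))⁻¹ - 1) =
      (B⁻¹ * A⁻¹ / (z - w) - B⁻¹) * (w - (x : ℂ))⁻¹ -
        (B⁻¹ * A⁻¹ / (z - w) + A⁻¹) * (z - (x : ℂ))⁻¹ + 1 := by
    have := sub_ofReal_ne_zero hz x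
    have := sub_ofReal_ne_zero hw x
    field_simp
    ring
  simp only [hexp]
  have hsubi (u v : ℂ) : Integrable (fun x : ℝ => u * (w - (x : ℂ))⁻¹ - v * (z - (x : ℂ))⁻¹) μ :=
    (hiw.const_mul u).sub (hiz.const_mul v)
  rw [integral_add (hsubi _ _) (integrable_const 1),
    integral_sub (hiw.const_mul _) (hiz.const_mul _), integral_const_mul, integral_const_mul,
    ← hA, ← hB]
  simp only [integral_const, probReal_univ, one_smul]
  field_simp
  ring

theorem norm_integral_compressedResolvent_mul_lt_one {w : ℂ}
    (h2 : Integrable (fun x : ℝ => x ^ 2) μ)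
    (hz : Real.sqrt (∫ x : ℝ, x ^ 2 ∂μ) < z.im) (hw : Real.sqrt (∫ x : ℝ, x ^ 2 ∂μ) < w.im) :
    ‖∫ x, compressedResolvent μ z x * compressedResolvent μ w x ∂μ‖ < 1 := by
  have hiz := integrable_normSq_compressedResolvent μ ((Real.sqrt_nonneg _).trans_lt hz)
  have hiw := integrable_normSq_compressedResolvent μ ((Real.sqrt_nonneg _).trans_lt hw)
  have hle := norm_integral_le_of_norm_le ((hiz.add hiw).div_const 2) (.of_forall fun x => by
    simp only [Pi.add_apply, norm_mul, normSq_eq_norm_sq]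
    linarith [two_mul_le_add_sq ‖compressedResolvent μ z x‖ ‖compressedResolvent μ w x‖] :
      ∀ᵐ x ∂μ, ‖compressedResolvent μ z x * compressedResolvent μ w x‖ ≤ _)
  simp only [Pi.add_apply] at hle
  rw [integral_div, integral_add hiz hiw] at hle
  linarith [integral_normSq_compressedResolvent_lt_one μ h2 hz,
    integral_normSq_compressedResolvent_lt_one μ h2 hw]

end compressedResolvent

/-- If a probability measure `μ` on `ℝ` has mean `0` and finite variance
`σ² = ∫ x² dμ(x)`, then its `F`-transform `F_μ(z) = 1/∫ 1/(z-x) dμ(x)` is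
injective on the half-plane `{z : Im z > σ}`. -/
theorem F_transform_injOn_of_finite_variance (μ : Measure ℝ) [IsProbabilityMeasure μ]
    (h2 : Integrable (fun x : ℝ => x ^ 2) μ) (hmean : ∫ x : ℝ, x ∂μ = 0) :
    Set.InjOn (fun z : ℂ => (∫ x : ℝ, (z - (x : ℂ))⁻¹ ∂μ)⁻¹)
      {z : ℂ | Real.sqrt (∫ x : ℝ, x ^ 2 ∂μ) < z.im} := by
  intro z hz w hw heq
  simp only [mem_ofPred_eq] at hz hw heq
  by_contra hne
  have hlt := norm_integral_compressedResolvent_mul_lt_one μ h2 hz hw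
  rw [integral_compressedResolvent_mul μ ((Real.sqrt_nonneg _).trans_lt hz)
    ((Real.sqrt_nonneg _).trans_lt hw) hne, heq] at hlt
  simp at hlt
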